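/- Let f ≥ 1. Then in S_{2f} one has H_f(2f) = H_{f−1}^{{3,…,2f}} · D_{(1,2f−2)}^{{2,…,2f}}: every d ∈ H_f(2f) factors uniquely as d = u·v with u in the image of H_{f−1}(2f−2) under the embedding of S_{2f−2} into S_{2f} as the permutations of {3,…,2f}, and v in the image of the minimal-length right coset representatives D_{(1,2f−2)} ⊆ S_{2f−1} under the embedding of S_{2f−1} into S_{2f} as the permutations of {2,…,2f}; moreover ℓ(d) = ℓ(u) + ℓ(v), and conversely every such product lies in H_f(2f). -/

import Mathlib

open Finset
open scoped Pointwise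

namespace BMWPaper

/-- The Coxeter length of a permutation of `Fin n`: the number of inversions. -/
def len {n : ℕ} (w : Equiv.Perm (Fin n)) : ℕ :=
  (Finset.univ.filter (fun p : Fin n × Fin n => p.1 < p.2 ∧ w p.2 < w p.1)).card

/-- `sGen n i` is the adjacent transposition `s_i = (i, i+1)` (1-based) in `S_n`;
it is the identity for out-of-range `i`. -/
def sGen (n i : ℕ) : Equiv.Perm (Fin n) :=
  if h : 1 ≤ i ∧ i < n then Equiv.swap ⟨i - 1, by omega⟩ ⟨i, h.2⟩ else 1

/-- `pimg d i` is the (1-based) image `(i)d` of the point `i ∈ {1,…,n}` under the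
*right* action of the permutation `d` (permutations act on points on the right,
so that `(a)(στ) = ((a)σ)τ` for the group multiplication `σ * τ`);
the junk value `0` is returned for out-of-range `i`. -/
def pimg {n : ℕ} (d : Equiv.Perm (Fin n)) (i : ℕ) : ℕ :=
  if h : i - 1 < n then ((d⁻¹ ⟨i - 1, h⟩ : Fin n) : ℕ) + 1 else 0

open scoped Classical in
/-- `Hset n f` is the set `H_f(n)` of all `d ∈ S_n` such that
`(1)d < (3)d < ⋯ < (2f-1)d`, `(2i-1)d < (2i)d` for `i = 1,…,f`, and
`(2f+1)d < (2f+2)d < ⋯ < (n)d`. -/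
noncomputable def Hset (n f : ℕ) : Finset (Equiv.Perm (Fin n)) :=
  Finset.univ.filter (fun d =>
    (∀ i ∈ Finset.Icc 1 (f - 1), pimg d (2 * i - 1) < pimg d (2 * i + 1)) ∧
    (∀ i ∈ Finset.Icc 1 f, pimg d (2 * i - 1) < pimg d (2 * i)) ∧
    (∀ j ∈ Finset.Icc (2 * f + 1) (n - 1), pimg d j < pimg d (j + 1)))

/-- The index of the block of the composition `μ` containing the (0-based) point `k`. -/
def blockOf (μ : List ℕ) (k : ℕ) : ℕ :=
  ((List.range μ.length).filter (fun j => (μ.take (j + 1)).sum ≤ k)).length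

open scoped Classical in
/-- The Young subgroup `S_μ` of `S_n` associated with a composition `μ` of `n`,
as the set of permutations preserving each of the consecutive blocks of `μ`. -/
noncomputable def youngSet (n : ℕ) (μ : List ℕ) : Finset (Equiv.Perm (Fin n)) :=
  Finset.univ.filter (fun w => ∀ a : Fin n, blockOf μ ((w a : ℕ)) = blockOf μ (a : ℕ))

open scoped Classical in
/-- The set `D_μ` of minimal-length right coset representatives of `S_μ` in `S_n`:
the elements of minimal length in their right coset `S_μ d`. -/
noncomputable def Dset (n : ℕ) (μ : List ℕ) : Finset (Equiv.Perm (Fin n)) :=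
  Finset.univ.filter (fun d => ∀ u ∈ youngSet n μ, len d ≤ len (u * d))

/-- The identification of `Fin m` with the block `[k, k+m)` of `Fin n` (0-based). -/
def shiftEquiv (n k m : ℕ) (h : k + m ≤ n) :
    Fin m ≃ {a : Fin n // k ≤ (a : ℕ) ∧ (a : ℕ) < k + m} where
  toFun b := ⟨⟨k + (b : ℕ), by have := b.isLt; omega⟩, by
    constructor
    · exact Nat.le_add_right _ _
    · have := b.isLt; simp only [Fin.val_mk]; omega⟩
  invFun a := ⟨(a : Fin n) - k, by have := a.2; omega⟩
  left_inv b := by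
    apply Fin.ext
    simp
  right_inv a := by
    apply Subtype.ext
    apply Fin.ext
    have := a.2
    simp only []
    omega

open scoped Classical in
/-- The embedding of `S_m` into `S_n` as the group of permutations of the
(1-based) block `{k+1, …, k+m}` of `{1, …, n}`. -/
noncomputable def shiftEmb (n k m : ℕ) (w : Equiv.Perm (Fin m)) : Equiv.Perm (Fin n) :=
  if h : k + m ≤ n then w.extendDomain (shiftEquiv n k m h) else 1

open scoped Classical in
/-- The subgroup of `S_n` of permutations fixing the (1-based) points `1, …, k`. -/
noncomputable def fixSet (n k : ℕ) : Finset (Equiv.Perm (Fin n)) :=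
  Finset.univ.filter (fun w => ∀ a : Fin n, (a : ℕ) < k → w a = a)


/-- `bbs n i` is the permutation `𝕤_i = s_{2i} s_{2i-1} s_{2i+1} s_{2i} = (2i-1, 2i+1)(2i, 2i+2)`. -/
def bbs (n i : ℕ) : Equiv.Perm (Fin n) :=
  sGen n (2 * i) * sGen n (2 * i - 1) * sGen n (2 * i + 1) * sGen n (2 * i)

open scoped Classical in
/-- The set `𝔻_{(1,f-1)} = {𝕤_1 𝕤_2 ⋯ 𝕤_k : k = 0, …, f-1}` in `S_{2f}`. -/
noncomputable def bbD1 (f : ℕ) : Finset (Equiv.Perm (Fin (2 * f))) :=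
  (Finset.range f).image (fun k => ((List.range k).map (fun j => bbs (2 * f) (j + 1))).prod)

open scoped Classical in
/-- The set `𝔻_{(1,f-2)}^{{2,…,f}} = {𝕤_2 𝕤_3 ⋯ 𝕤_k : k = 1, …, f-1}` in `S_{2f}`. -/
noncomputable def bbD1' (f : ℕ) : Finset (Equiv.Perm (Fin (2 * f))) :=
  (Finset.Icc 1 (f - 1)).image
    (fun k => ((List.range (k - 1)).map (fun j => bbs (2 * f) (j + 2))).prod)

open scoped Classical in
/-- `H_f^{(a)} = {d ∈ H_f(n) : (1)d⁻¹ = 1, (2)d⁻¹ = 2}`. -/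
noncomputable def HsetA (n f : ℕ) : Finset (Equiv.Perm (Fin n)) :=
  (Hset n f).filter (fun d => pimg d⁻¹ 1 = 1 ∧ pimg d⁻¹ 2 = 2)

open scoped Classical in
/-- `H_f^{(b)} = {d ∈ H_f(n) : (1)d⁻¹ = 1, (2)d⁻¹ = 3}`. -/
noncomputable def HsetB (n f : ℕ) : Finset (Equiv.Perm (Fin n)) :=
  (Hset n f).filter (fun d => pimg d⁻¹ 1 = 1 ∧ pimg d⁻¹ 2 = 3)

open scoped Classical in
/-- `H_f^{(c)} = {d ∈ H_f(n) : (1)d⁻¹ = 1, (2)d⁻¹ = 2f+1}`. -/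
noncomputable def HsetC (n f : ℕ) : Finset (Equiv.Perm (Fin n)) :=
  (Hset n f).filter (fun d => pimg d⁻¹ 1 = 1 ∧ pimg d⁻¹ 2 = 2 * f + 1)

open scoped Classical in
/-- `H_f^{(d)} = {d ∈ H_f(n) : (1)d⁻¹ = 2f+1, (2)d⁻¹ = 1}`. -/
noncomputable def HsetD (n f : ℕ) : Finset (Equiv.Perm (Fin n)) :=
  (Hset n f).filter (fun d => pimg d⁻¹ 1 = 2 * f + 1 ∧ pimg d⁻¹ 2 = 1)

open scoped Classical in
/-- `H_f^{(e)} = {d ∈ H_f(n) : (1)d⁻¹ = 2f+1, (2)d⁻¹ = 2f+2}`. -/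
noncomputable def HsetE (n f : ℕ) : Finset (Equiv.Perm (Fin n)) :=
  (Hset n f).filter (fun d => pimg d⁻¹ 1 = 2 * f + 1 ∧ pimg d⁻¹ 2 = 2 * f + 2)

section Algebra

variable {F : Type*} [Field F] {A : Type*} [Ring A] [Algebra F A]

/-- For a set `S` of permutations, `hat c Tw S = Σ_{w ∈ S} c^{ℓ(w)} T_w`. -/
noncomputable def hat {n : ℕ} (c : F) (Tw : Equiv.Perm (Fin n) → A)
    (S : Finset (Equiv.Perm (Fin n))) : A :=
  ∑ w ∈ S, c ^ len w • Tw w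

/-- `Ehat E f = E_1 E_3 ⋯ E_{2f-1}`. -/
def Ehat (E : ℕ → A) (f : ℕ) : A := ((List.range f).map (fun i => E (2 * i + 1))).prod

/-- `Tprod T a b = T_a T_{a+1} ⋯ T_b` (the empty product `1` if `b < a`). -/
def Tprod (T : ℕ → A) (a b : ℕ) : A := ((List.range (b + 1 - a)).map (fun t => T (a + t))).prod

/-- `sDesc n a b = s_a s_{a-1} ⋯ s_b` (descending product of adjacent transpositions). -/
def sDesc (n a b : ℕ) : Equiv.Perm (Fin n) :=
  ((List.range (a + 1 - b)).map (fun j => sGen n (a - j))).prod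

/-- The data of a Birman–Murakami–Wenzl algebra structure: an `F`-algebra `A`
with invertible elements `T_1, …, T_{n-1}` and elements `E_1, …, E_{n-1}`
satisfying the BMW relations, together with a map `w ↦ T_w` from `S_n` to `A`
with `T_id = 1`, `T_{s_i} = T_i` and `T_{uv} = T_u T_v` whenever lengths add. -/
structure BMWData (F : Type*) [Field F] (A : Type*) [Ring A] [Algebra F A]
    (n : ℕ) (q r : F) where
  T : ℕ → A
  Tinv : ℕ → A
  E : ℕ → A
  Tw : Equiv.Perm (Fin n) → A
  hq : q ≠ 0
  hr : r ≠ 0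
  hqq : q - q⁻¹ ≠ 0
  T_mul_Tinv : ∀ i, 1 ≤ i → i ≤ n - 1 → T i * Tinv i = 1
  Tinv_mul_T : ∀ i, 1 ≤ i → i ≤ n - 1 → Tinv i * T i = 1
  skein : ∀ i, 1 ≤ i → i ≤ n - 1 → T i - Tinv i = (q - q⁻¹) • (1 - E i)
  Esq : ∀ i, 1 ≤ i → i ≤ n - 1 → E i * E i = (1 + (r - r⁻¹) / (q - q⁻¹)) • E i
  braid : ∀ i, 1 ≤ i → i + 1 ≤ n - 1 → T i * T (i + 1) * T i = T (i + 1) * T i * T (i + 1)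
  T_comm : ∀ i j, 1 ≤ i → i ≤ n - 1 → 1 ≤ j → j ≤ n - 1 → (i + 1 < j ∨ j + 1 < i) →
    T i * T j = T j * T i
  EEE₁ : ∀ i, 1 ≤ i → i + 1 ≤ n - 1 → E i * E (i + 1) * E i = E i
  EEE₂ : ∀ i, 1 ≤ i → i + 1 ≤ n - 1 → E (i + 1) * E i * E (i + 1) = E (i + 1)
  TTE₁ : ∀ i, 1 ≤ i → i + 1 ≤ n - 1 → T i * T (i + 1) * E i = E (i + 1) * E i
  TTE₂ : ∀ i, 1 ≤ i → i + 1 ≤ n - 1 → T (i + 1) * T i * E (i + 1) = E i * E (i + 1)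
  ET : ∀ i, 1 ≤ i → i ≤ n - 1 → E i * T i = r⁻¹ • E i
  TE : ∀ i, 1 ≤ i → i ≤ n - 1 → T i * E i = r⁻¹ • E i
  ETE₁ : ∀ i, 1 ≤ i → i + 1 ≤ n - 1 → E i * T (i + 1) * E i = r • E i
  ETE₂ : ∀ i, 1 ≤ i → i + 1 ≤ n - 1 → E (i + 1) * T i * E (i + 1) = r • E (i + 1)
  Tw_one : Tw 1 = 1
  Tw_s : ∀ i, 1 ≤ i → i ≤ n - 1 → Tw (sGen n i) = T i
  Tw_mul : ∀ u v : Equiv.Perm (Fin n), len (u * v) = len u + len v →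
    Tw (u * v) = Tw u * Tw v

/-- The scalars `a_f` defined by `a_0 = 1` and `a_i = a_{i-1} · Σ_{k=0}^{i-1} q^{2k}`. -/
noncomputable def aseq (q : F) : ℕ → F
  | 0 => 1
  | (i + 1) => aseq q i * (∑ k ∈ Finset.range (i + 1), q ^ (2 * k))


/-- The scalars `c_f` defined by `c_0 = 1` and
`c_f = -((q^{4f-3} - q^{2f-3})/(r q^{2n-2f-2} - q⁻¹)) · c_{f-1}`. -/
noncomputable def cseq (q r : F) (n : ℕ) : ℕ → F
  | 0 => 1
  | (f + 1) =>
      -((q ^ (4 * ((f : ℤ) + 1) - 3) - q ^ (2 * ((f : ℤ) + 1) - 3)) /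
          (r * q ^ (2 * (n : ℤ) - 2 * ((f : ℤ) + 1) - 2) - q⁻¹)) * cseq q r n f

/-- The scalars `č_f` defined by `č_0 = 1` and
`č_f = (q^{3-4f}(1 - q^{2f})/(q + r q^{2+2f-2n})) · č_{f-1}` (with integer exponents). -/
noncomputable def ccseq (q r : F) (n : ℕ) : ℕ → F
  | 0 => 1
  | (f + 1) =>
      (q ^ ((3 : ℤ) - 4 * ((f : ℤ) + 1)) * (1 - q ^ (2 * (f + 1))) /
          (q + r * q ^ ((2 : ℤ) + 2 * ((f : ℤ) + 1) - 2 * (n : ℤ)))) * ccseq q r n f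

/-- The element `x_f = (H_f⁻¹)^ · Ŝ_{{2f+1,…,n}} · Ê_f · Ĥ_f` of the BMW algebra. -/
noncomputable def xEl {F : Type*} [Field F] {A : Type*} [Ring A] [Algebra F A]
    {n : ℕ} {q r : F} (D : BMWData F A n q r) (f : ℕ) : A :=
  hat q D.Tw ((Hset n f).image (fun d => d⁻¹)) * hat q D.Tw (fixSet n (2 * f)) *
    Ehat D.E f * hat q D.Tw (Hset n f)

/-- The element `x̌_f = (H_f⁻¹)ˇ · Š_{{2f+1,…,n}} · Ê_f · Ȟ_f` of the BMW algebra,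
where `ˇ` is formed with `-q⁻¹` in place of `q`. -/
noncomputable def xElCheck {F : Type*} [Field F] {A : Type*} [Ring A] [Algebra F A]
    {n : ℕ} {q r : F} (D : BMWData F A n q r) (f : ℕ) : A :=
  hat (-q⁻¹) D.Tw ((Hset n f).image (fun d => d⁻¹)) * hat (-q⁻¹) D.Tw (fixSet n (2 * f)) *
    Ehat D.E f * hat (-q⁻¹) D.Tw (Hset n f)

end Algebra

/-- `w` fixes every point of `Fin n` below `k`. -/
def FixesBelow {n : ℕ} (k : ℕ) (w : Equiv.Perm (Fin n)) : Prop :=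
  ∀ a : Fin n, (a : ℕ) < k → w a = a

/-- `v⁻¹` is increasing on the points of `Fin n` that are at least `k`. -/
def SortedFrom {n : ℕ} (k : ℕ) (v : Equiv.Perm (Fin n)) : Prop :=
  ∀ a b : Fin n, k ≤ (a : ℕ) → a < b → v⁻¹ a < v⁻¹ b

/-- The order conditions defining `H_f(2f)`, on the 0-based points that are at least `c`. -/
def PairedFrom {n : ℕ} (c : ℕ) (d : Equiv.Perm (Fin n)) : Prop :=
  ∀ x y : Fin n, c ≤ (x : ℕ) → (x : ℕ) % 2 = 0 →
    ((y : ℕ) = x + 1 ∨ (y : ℕ) = x + 2) → d⁻¹ x < d⁻¹ y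

namespace FixesBelow

variable {n k : ℕ} {w w' : Equiv.Perm (Fin n)}

lemma inv (hw : FixesBelow k w) : FixesBelow k w⁻¹ := fun a ha => by
  rw [Equiv.Perm.inv_eq_iff_eq, hw a ha]

lemma mul (hw : FixesBelow k w) (hw' : FixesBelow k w') : FixesBelow k (w * w') := fun a ha => by
  rw [Equiv.Perm.mul_apply, hw' a ha, hw a ha]

lemma mono {j : ℕ} (hw : FixesBelow k w) (hj : j ≤ k) : FixesBelow j w :=
  fun a ha => hw a (ha.trans_le hj)

lemma le_apply (hw : FixesBelow k w) {a : Fin n} (ha : k ≤ (a : ℕ)) : k ≤ (w a : ℕ) := by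
  by_contra! h
  have h1 := hw (w a) h
  rw [w.injective h1] at h
  omega

end FixesBelow

lemma len_mul {n k : ℕ} {u v : Equiv.Perm (Fin n)} (hu : FixesBelow k u) (hv : SortedFrom k v) :
    len (u * v) = len u + len v := by
  classical
  have himg : (univ.filter (fun p : Fin n × Fin n => p.1 < p.2 ∧ u p.2 < u p.1)).card =
      ((univ.filter (fun p : Fin n × Fin n => p.1 < p.2 ∧ u p.2 < u p.1)).map
        (Equiv.prodCongr v⁻¹ v⁻¹).toEmbedding).card := (card_map _).symm
  unfold len
  rw [himg, ← card_union_of_disjoint]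
  · congr 1
    ext ⟨x, y⟩
    rw [mem_union, mem_map_equiv, mem_filter, mem_filter, mem_filter]
    simp only [mem_univ, true_and]
    change (x < y ∧ u (v y) < u (v x)) ↔
      (v x < v y ∧ u (v y) < u (v x)) ∨ (x < y ∧ v y < v x)
    constructor
    · rintro ⟨hxy, h⟩
      rcases lt_trichotomy (v x) (v y) with h1 | h1 | h1
      · exact Or.inl ⟨h1, h⟩
      · rw [h1] at h
        exact absurd h (lt_irrefl _)
      · exact Or.inr ⟨hxy, h1⟩
    · rintro (⟨h1, h⟩ | ⟨hxy, h1⟩)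
      · refine ⟨?_, h⟩
        by_cases hk : k ≤ (v x : ℕ)
        · simpa using hv _ _ hk h1
        · exfalso
          rw [hu (v x) (by omega)] at h
          by_cases hk2 : k ≤ (v y : ℕ)
          · have := hu.le_apply hk2
            rw [Fin.lt_def] at h
            omega
          · rw [hu (v y) (by omega)] at h
            exact lt_asymm h h1
      · refine ⟨hxy, ?_⟩
        by_cases hk : k ≤ (v y : ℕ)
        · have := hv _ _ hk h1
          simp only [Equiv.Perm.inv_def, Equiv.symm_apply_apply] at this
          exact absurd this (lt_asymm hxy)
        · rw [hu (v y) (by omega)]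
          by_cases hk2 : k ≤ (v x : ℕ)
          · have := hu.le_apply hk2
            rw [Fin.lt_def]
            omega
          · rwa [hu (v x) (by omega)]
  · rw [disjoint_left]
    rintro ⟨x, y⟩ h1 h2
    simp only [mem_filter, mem_univ, true_and, mem_map_equiv] at h1 h2
    exact lt_asymm (show v x < v y from h1.1) h2.2

lemma eq_one_of_len_eq_zero {n : ℕ} {w : Equiv.Perm (Fin n)} (h : len w = 0) : w = 1 := by
  have hm : StrictMono w := fun a b hab => by
    have h1 := card_eq_zero.1 h
    have h2 : (a, b) ∉ univ.filter (fun p : Fin n × Fin n => p.1 < p.2 ∧ w p.2 < w p.1) := by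
      simp [h1]
    simp only [mem_filter, mem_univ, true_and, not_and, not_lt] at h2
    exact lt_of_le_of_ne (h2 hab) (fun e => hab.ne (w.injective e))
  have h3 : hm.orderIsoOfSurjective _ w.surjective = OrderIso.refl _ := Subsingleton.elim _ _
  ext a
  exact congrArg Fin.val (DFunLike.congr_fun h3 a)

lemma factor_unique {n k : ℕ} {u u' v v' : Equiv.Perm (Fin n)} (hu : FixesBelow k u)
    (hu' : FixesBelow k u') (hv : SortedFrom k v) (hv' : SortedFrom k v') (h : u * v = u' * v') :
    u = u' ∧ v = v' := by
  have h1 := len_mul (hu'.inv.mul hu) hv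
  have h2 := len_mul (hu.inv.mul hu') hv'
  have e1 : u'⁻¹ * u * v = v' := by rw [mul_assoc, h]; group
  have e2 : u⁻¹ * u' * v' = v := by rw [mul_assoc, ← h]; group
  rw [e1] at h1
  rw [e2] at h2
  have h3 := eq_one_of_len_eq_zero (w := u'⁻¹ * u) (by omega)
  have h4 : u = u' := (inv_mul_eq_one.1 h3).symm
  subst h4
  exact ⟨rfl, mul_left_cancel h⟩

section shiftEmb

variable {n k m : ℕ}

lemma shiftEmb_apply (h : k + m ≤ n) (w : Equiv.Perm (Fin m)) (b : Fin m) (hb : k + (b : ℕ) < n) :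
    ((shiftEmb n k m w ⟨k + b, hb⟩ : Fin n) : ℕ) = k + (w b : ℕ) := by
  rw [shiftEmb, dif_pos h]
  have := Equiv.Perm.extendDomain_apply_image w (shiftEquiv n k m h) b
  exact congrArg Fin.val this

lemma shiftEmb_inv (w : Equiv.Perm (Fin m)) : (shiftEmb n k m w)⁻¹ = shiftEmb n k m w⁻¹ := by
  unfold shiftEmb
  split_ifs
  · rw [Equiv.Perm.extendDomain_inv]
  · simp

lemma fixesBelow_shiftEmb (w : Equiv.Perm (Fin m)) : FixesBelow k (shiftEmb n k m w) := by
  intro a ha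
  unfold shiftEmb
  split_ifs
  · exact Equiv.Perm.extendDomain_apply_not_subtype _ _ (by omega)
  · rfl

lemma exists_shiftEmb_eq (h : k + m = n) {w : Equiv.Perm (Fin n)} (hw : FixesBelow k w) :
    ∃ w', shiftEmb n k m w' = w := by
  have hp : ∀ a : Fin n, (k ≤ (w a : ℕ) ∧ (w a : ℕ) < k + m) ↔ (k ≤ (a : ℕ) ∧ (a : ℕ) < k + m) := by
    intro a
    constructor
    · intro h1
      refine ⟨?_, by omega⟩
      by_contra! h2
      rw [hw a h2] at h1
      omega
    · exact fun h1 => ⟨hw.le_apply h1.1, by omega⟩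
  refine ⟨(shiftEquiv n k m h.le).symm.permCongr (w.subtypePerm hp), ?_⟩
  ext a
  by_cases ha : (a : ℕ) < k
  · rw [fixesBelow_shiftEmb _ a ha, hw a ha]
  · have : a = ⟨k + ((⟨a - k, by omega⟩ : Fin m) : ℕ), by simp; omega⟩ := by
      ext; simp; omega
    conv_lhs => rw [this]
    rw [shiftEmb_apply h.le]
    have hge := hw.le_apply (not_lt.1 ha)
    simp only [Equiv.permCongr_apply, Equiv.symm_symm, shiftEquiv, Equiv.coe_fn_mk,
      Equiv.coe_fn_symm_mk, Equiv.Perm.subtypePerm_apply]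
    have e : (⟨k + (a - k), by omega⟩ : Fin n) = a := by ext; simp; omega
    simp only [e]
    omega

end shiftEmb

lemma exists_factor {n : ℕ} (k : ℕ) (v : Equiv.Perm (Fin n)) :
    ∃ u, FixesBelow k u ∧ SortedFrom k (u⁻¹ * v) := by
  rcases lt_or_ge n k with hk | hk
  · exact ⟨1, fun _ _ => rfl, fun a b ha _ => by omega⟩
  have hkm : k + (n - k) = n := by omega
  let g : Fin (n - k) → Fin n := fun b => v⁻¹ ⟨k + b, by omega⟩
  refine ⟨shiftEmb n k (n - k) (Tuple.sort g), fixesBelow_shiftEmb _, ?_⟩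
  have key : ∀ (a : Fin n) (ha : k ≤ (a : ℕ)),
      v⁻¹ (shiftEmb n k (n - k) (Tuple.sort g) a) = g (Tuple.sort g ⟨a - k, by omega⟩) := by
    intro a ha
    have e : a = ⟨k + ((⟨a - k, by omega⟩ : Fin (n - k)) : ℕ), by simp; omega⟩ := by
      ext; simp; omega
    conv_lhs => rw [e]
    congr 1
    ext
    rw [shiftEmb_apply hkm.le]
  intro a b ha hab
  rw [mul_inv_rev, inv_inv, Equiv.Perm.mul_apply, Equiv.Perm.mul_apply]
  refine lt_of_le_of_ne ?_ (fun e => hab.ne (by simpa using e))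
  rw [key a ha, key b (ha.trans hab.le)]
  exact Tuple.monotone_sort g (by rw [Fin.le_def]; simp only; omega)

lemma blockOf_eq_zero_iff (m k : ℕ) (hk : k < m + 1) : blockOf [1, m] k = 0 ↔ k = 0 := by
  have : (List.range [1, m].length) = [0, 1] := rfl
  rw [blockOf, this]
  rcases Nat.eq_zero_or_pos k with h | h
  · subst h; simp
  · simp [List.filter_cons, Nat.succ_le_of_lt h]
    omega

lemma blockOf_of_pos {m k : ℕ} (h : 0 < k) (hk : k < m + 1) : blockOf [1, m] k = 1 := by
  have : (List.range [1, m].length) = [0, 1] := rfl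
  rw [blockOf, this]
  simp [List.filter_cons, Nat.succ_le_of_lt h]
  omega

lemma mem_youngSet_iff {n m : ℕ} (h : n = m + 1) (w : Equiv.Perm (Fin n)) :
    w ∈ youngSet n [1, m] ↔ FixesBelow 1 w := by
  simp only [youngSet, mem_filter, mem_univ, true_and]
  constructor
  · intro hw a ha
    have h1 := hw a
    have h2 : (a : ℕ) = 0 := by omega
    rw [(blockOf_eq_zero_iff m a (by omega)).2 h2, blockOf_eq_zero_iff m _ (by omega)] at h1
    ext
    omega
  · intro hw a
    rcases Nat.eq_zero_or_pos (a : ℕ) with h0 | h0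
    · rw [hw a (by omega)]
    · have := hw.le_apply (Nat.succ_le_of_lt h0)
      rw [blockOf_of_pos h0 (by omega), blockOf_of_pos (by omega) (by omega)]

lemma mem_Dset_iff {n m : ℕ} (h : n = m + 1) (v : Equiv.Perm (Fin n)) :
    v ∈ Dset n [1, m] ↔ SortedFrom 1 v := by
  simp only [Dset, mem_filter, mem_univ, true_and, mem_youngSet_iff h]
  constructor
  · intro hv
    obtain ⟨u, hu, hs⟩ := exists_factor 1 v
    have h1 := hv u⁻¹ hu.inv
    have h2 := len_mul hu hs
    rw [mul_inv_cancel_left] at h2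
    have h3 := eq_one_of_len_eq_zero (w := u) (by omega)
    simpa [h3] using hs
  · intro hv u hu
    rw [len_mul hu hv]
    omega

lemma mem_image_Dset_iff {n m : ℕ} (h : n = m + 2) (v : Equiv.Perm (Fin n)) :
    v ∈ (Dset (n - 1) [1, m]).image (shiftEmb n 1 (n - 1)) ↔ FixesBelow 1 v ∧ SortedFrom 2 v := by
  have hle : 1 + (n - 1) = n := by omega
  have key : ∀ w : Equiv.Perm (Fin (n - 1)),
      SortedFrom 1 w ↔ SortedFrom 2 (shiftEmb n 1 (n - 1) w) := by
    intro w
    constructor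
    · intro hw a b ha hab
      rw [shiftEmb_inv]
      have ea : a = ⟨1 + ((⟨a - 1, by omega⟩ : Fin (n - 1)) : ℕ), by simp; omega⟩ := by
        ext; simp; omega
      have eb : b = ⟨1 + ((⟨b - 1, by omega⟩ : Fin (n - 1)) : ℕ), by simp; omega⟩ := by
        ext; simp; omega
      rw [ea, eb, Fin.lt_def, shiftEmb_apply hle.le, shiftEmb_apply hle.le]
      exact Nat.add_lt_add_left (hw _ _ (by simp only; omega)
        (by rw [Fin.lt_def]; simp only; omega)) 1
    · intro hw a b ha hab
      have := hw ⟨1 + a, by omega⟩ ⟨1 + b, by omega⟩ (by simp only; omega)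
        (by rw [Fin.lt_def]; simp only; omega)
      rw [shiftEmb_inv, Fin.lt_def, shiftEmb_apply hle.le, shiftEmb_apply hle.le] at this
      rw [Fin.lt_def]
      omega
  simp only [mem_image, mem_Dset_iff (show n - 1 = m + 1 by omega)]
  constructor
  · rintro ⟨w, hw, rfl⟩
    exact ⟨fixesBelow_shiftEmb w, (key w).1 hw⟩
  · rintro ⟨h1, h2⟩
    obtain ⟨w, rfl⟩ := exists_shiftEmb_eq hle h1
    exact ⟨w, (key w).2 h2, rfl⟩

lemma pimg_lt_pimg_iff {n : ℕ} (d : Equiv.Perm (Fin n)) {x y : Fin n} {i j : ℕ}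
    (hi : i = x + 1) (hj : j = y + 1) : pimg d i < pimg d j ↔ d⁻¹ x < d⁻¹ y := by
  subst hi hj
  simp [pimg]

lemma mem_Hset_iff {n f : ℕ} (h : n = 2 * f) (d : Equiv.Perm (Fin n)) :
    d ∈ Hset n f ↔ PairedFrom 0 d := by
  simp only [Hset, mem_filter, mem_univ, true_and, mem_Icc]
  constructor
  · rintro ⟨h1, h2, -⟩ x y - hx (hy | hy)
    · exact (pimg_lt_pimg_iff d (by omega) (by omega)).1 (h2 (x / 2 + 1) (by omega))
    · exact (pimg_lt_pimg_iff d (by omega) (by omega)).1 (h1 (x / 2 + 1) (by omega))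
  · intro hd
    refine ⟨fun i hi => ?_, fun i hi => ?_, fun j hj => by omega⟩
    · refine (pimg_lt_pimg_iff d (x := ⟨2 * i - 2, by omega⟩) (y := ⟨2 * i, by omega⟩)
        (by simp only; omega) (by simp only)).2 (hd _ _ ?_ ?_ ?_) <;> simp only <;> omega
    · refine (pimg_lt_pimg_iff d (x := ⟨2 * i - 2, by omega⟩) (y := ⟨2 * i - 1, by omega⟩)
        (by simp only; omega) (by simp only; omega)).2 (hd _ _ ?_ ?_ ?_) <;> simp only <;> omega

lemma mem_image_Hset_iff {n f : ℕ} (h : n = 2 * f) (hf : 1 ≤ f) (u : Equiv.Perm (Fin n)) :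
    u ∈ (Hset (n - 2) (f - 1)).image (shiftEmb n 2 (n - 2)) ↔
      FixesBelow 2 u ∧ PairedFrom 2 u := by
  have hle : 2 + (n - 2) = n := by omega
  have key : ∀ w : Equiv.Perm (Fin (n - 2)),
      PairedFrom 0 w ↔ PairedFrom 2 (shiftEmb n 2 (n - 2) w) := by
    intro w
    constructor
    · intro hw a b ha ha2 hab
      rw [shiftEmb_inv]
      have ea : a = ⟨2 + ((⟨a - 2, by omega⟩ : Fin (n - 2)) : ℕ), by simp; omega⟩ := by
        ext; simp; omega
      have eb : b = ⟨2 + ((⟨b - 2, by omega⟩ : Fin (n - 2)) : ℕ), by simp; omega⟩ := by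
        ext; simp; omega
      rw [ea, eb, Fin.lt_def, shiftEmb_apply hle.le, shiftEmb_apply hle.le]
      exact Nat.add_lt_add_left (hw _ _ (Nat.zero_le _) (by simp only; omega)
        (by simp only; omega)) 2
    · intro hw a b _ ha2 hab
      have := hw ⟨2 + a, by omega⟩ ⟨2 + b, by omega⟩ (by simp only; omega)
        (by simp only; omega) (by simp only; omega)
      rw [shiftEmb_inv, Fin.lt_def, shiftEmb_apply hle.le, shiftEmb_apply hle.le] at this
      rw [Fin.lt_def]
      omega
  simp only [mem_image, mem_Hset_iff (show n - 2 = 2 * (f - 1) by omega)]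
  constructor
  · rintro ⟨w, hw, rfl⟩
    exact ⟨fixesBelow_shiftEmb w, (key w).1 hw⟩
  · rintro ⟨h1, h2⟩
    obtain ⟨w, rfl⟩ := exists_shiftEmb_eq hle h1
    exact ⟨w, (key w).2 h2, rfl⟩

lemma PairedFrom.fixesBelow_one {n : ℕ} {d : Equiv.Perm (Fin n)} (hd : PairedFrom 0 d) :
    FixesBelow 1 d := by
  intro a ha
  have ha0 : (a : ℕ) = 0 := by omega
  have key : ∀ (j : ℕ) (hj : j < n), d⁻¹ a ≤ d⁻¹ ⟨j, hj⟩ := by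
    intro j
    induction j using Nat.strong_induction_on with
    | _ j ih =>
      intro hj
      rcases Nat.eq_zero_or_pos j with h0 | h0
      · rw [show a = ⟨j, hj⟩ by ext; simp only; omega]
      · by_cases hp : j % 2 = 0
        · exact (ih (j - 2) (by omega) (by omega)).trans
            (hd _ _ (Nat.zero_le _) (by simp only; omega) (by simp only; omega)).le
        · exact (ih (j - 1) (by omega) (by omega)).trans
            (hd _ _ (Nat.zero_le _) (by simp only; omega) (by simp only; omega)).le
  have h1 := key (d a) (d a).2
  rw [Fin.eta, Equiv.Perm.inv_def, Equiv.symm_apply_apply, ← Equiv.Perm.inv_def, Fin.le_def] at h1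
  rw [eq_comm, ← Equiv.Perm.inv_eq_iff_eq]
  ext
  omega

lemma SortedFrom.lt_iff {n k : ℕ} {v : Equiv.Perm (Fin n)} (hv : SortedFrom k v) {a b : Fin n}
    (ha : k ≤ (a : ℕ)) (hb : k ≤ (b : ℕ)) : v⁻¹ a < v⁻¹ b ↔ a < b := by
  refine ⟨fun h => ?_, hv a b ha⟩
  by_contra! h1
  rcases h1.lt_or_eq with h2 | h2
  · exact lt_asymm h (hv b a hb h2)
  · rw [h2] at h
    exact lt_irrefl _ h

lemma pairedFrom_mul_iff {n k : ℕ} {u v : Equiv.Perm (Fin n)} (hu : FixesBelow k u)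
    (hv : SortedFrom k v) : PairedFrom k (u * v) ↔ PairedFrom k u := by
  unfold PairedFrom
  refine forall₂_congr fun x y => forall_congr' fun hx => forall₂_congr fun _ hy => ?_
  rw [mul_inv_rev, Equiv.Perm.mul_apply, Equiv.Perm.mul_apply]
  exact hv.lt_iff (hu.inv.le_apply hx) (hu.inv.le_apply (by omega))

lemma PairedFrom.of_fixesBelow_one {n : ℕ} {d : Equiv.Perm (Fin n)} (hd : PairedFrom 2 d)
    (h1 : FixesBelow 1 d) : PairedFrom 0 d := by
  intro x y _ hx hy
  rcases Nat.eq_zero_or_pos (x : ℕ) with h0 | h0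
  · have := h1.inv.le_apply (a := y) (by omega)
    rw [h1.inv x (by omega), Fin.lt_def]
    omega
  · exact hd x y (by omega) hx hy

/-- For `f ≥ 1`, in `S_{2f}` one has
`H_f(2f) = H_{f-1}^{{3,…,2f}} · D_{(1,2f-2)}^{{2,…,2f}}` with unique factorizations,
lengths adding and the converse inclusion. -/
theorem statement7 (f : ℕ) (hf : 1 ≤ f) :
    (∀ d ∈ Hset (2 * f) f,
      (∃! uv : Equiv.Perm (Fin (2 * f)) × Equiv.Perm (Fin (2 * f)),
        uv.1 ∈ (Hset (2 * f - 2) (f - 1)).image (shiftEmb (2 * f) 2 (2 * f - 2)) ∧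
        uv.2 ∈ (Dset (2 * f - 1) [1, 2 * f - 2]).image (shiftEmb (2 * f) 1 (2 * f - 1)) ∧
        d = uv.1 * uv.2) ∧
      (∀ u v : Equiv.Perm (Fin (2 * f)),
        u ∈ (Hset (2 * f - 2) (f - 1)).image (shiftEmb (2 * f) 2 (2 * f - 2)) →
        v ∈ (Dset (2 * f - 1) [1, 2 * f - 2]).image (shiftEmb (2 * f) 1 (2 * f - 1)) →
        d = u * v → len d = len u + len v)) ∧
    (∀ u ∈ (Hset (2 * f - 2) (f - 1)).image (shiftEmb (2 * f) 2 (2 * f - 2)),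
      ∀ v ∈ (Dset (2 * f - 1) [1, 2 * f - 2]).image (shiftEmb (2 * f) 1 (2 * f - 1)),
        u * v ∈ Hset (2 * f) f) := by
  have hD := mem_image_Dset_iff (n := 2 * f) (m := 2 * f - 2) (by omega)
  have hH := mem_image_Hset_iff (n := 2 * f) rfl hf
  simp only [hD, hH, mem_Hset_iff (n := 2 * f) rfl]
  refine ⟨fun d hd => ⟨?_, ?_⟩, ?_⟩
  · obtain ⟨u, hu, hv⟩ := exists_factor 2 d
    have hd' : u * (u⁻¹ * d) = d := mul_inv_cancel_left u d
    refine ⟨(u, u⁻¹ * d), ⟨⟨hu, ?_⟩, ⟨?_, hv⟩, hd'.symm⟩, ?_⟩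
    · rw [← pairedFrom_mul_iff hu hv, hd']
      exact fun x y _ => hd x y (Nat.zero_le _)
    · exact (hu.mono one_le_two).inv.mul hd.fixesBelow_one
    · rintro ⟨u', v'⟩ ⟨hu', hv', h⟩
      obtain ⟨h1, h2⟩ := factor_unique hu'.1 hu hv'.2 hv (h.symm.trans hd'.symm)
      exact Prod.ext h1 h2
  · rintro u v hu hv rfl
    exact len_mul hu.1 hv.2
  · intro u hu v hv
    exact ((pairedFrom_mul_iff hu.1 hv.2).2 hu.2).of_fixesBelow_one
      ((hu.1.mono one_le_two).mul hv.1)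

end BMWPaper
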